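/- arXiv:2103.16171 — 4 statements merged into one kernel-verified Lean document; each statement's English description precedes it below -/
import Mathlib

section
/- Corollary 2 (LTI/frozen-coefficient form, dimension of the module of annihilators of bounded degree): let R ∈ M_{q×w}(ℝ[X]) be row reduced with row degrees L₁, …, L_q, and let L be an integer with L ≥ max_j L_j. Then the ℝ-vector space { n ∈ (ℝ[X])^{1×w} : deg n ≤ L − 1 and n = F·R for some F ∈ (ℝ[X])^{1×q} } has dimension exactly q·L − Σ_{j=1}^{q} L_j, with basis { Xⁱ·r_j : 1 ≤ j ≤ q, 0 ≤ i ≤ L − 1 − L_j }. -/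
/-!
Statement 10 (Corollary 2, LTI/frozen-coefficient form): the dimension of the module of
annihilators of degree at most `L − 1` (expressed as: each entry has `degree < L`) in the
ℝ[X]-row module of a row-reduced matrix `R` is `q·L − ∑ L_j`, with basis
`{Xⁱ·r_j : 0 ≤ i ≤ L − 1 − L_j}` (expressed as: the family is linearly independent over ℝ
and spans the subspace).
-/

open Polynomial

/-- The degree of a polynomial row vector: the maximum of the natural degrees of its
entries. -/
def rowDeg {w : ℕ} (r : Fin w → Polynomial ℝ) : ℕ :=
  Finset.univ.sup fun i => (r i).natDegree

/-- The leading row coefficient matrix of `R`: row `j` is the coefficient of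
`X ^ (rowDeg (R j))` in row `j` of `R`. -/
def leadingRowCoeffMat {q w : ℕ} (R : Matrix (Fin q) (Fin w) (Polynomial ℝ)) :
    Matrix (Fin q) (Fin w) ℝ :=
  fun j col => (R j col).coeff (rowDeg (R j))

/-- Coefficient extraction for a product whose formal top degree is at most `d`. -/
lemma coeff_mul_of_top_le {F r : Polynomial ℝ} {l d : ℕ} (hr : r.natDegree ≤ l)
    (hF : ∀ i, d < i + l → F.coeff i = 0) :
    (F * r).coeff d = (if l ≤ d then F.coeff (d - l) else 0) * r.coeff l := by
  rw [coeff_mul]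
  split_ifs with h
  · refine Finset.sum_eq_single (d - l, l) ?_ ?_
    · rintro ⟨a, b⟩ hab hne
      replace hab : a + b = d := Finset.HasAntidiagonal.mem_antidiagonal.1 hab
      rcases lt_trichotomy b l with hb | hb | hb
      · simp [hF a (by omega)]
      · exact absurd (by ext <;> simp <;> omega) hne
      · simp [coeff_eq_zero_of_natDegree_lt (lt_of_le_of_lt hr hb)]
    · intro hn
      exact absurd (Finset.HasAntidiagonal.mem_antidiagonal.2 (Nat.sub_add_cancel h)) hn
  · rw [zero_mul]
    refine Finset.sum_eq_zero ?_
    rintro ⟨a, b⟩ hab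
    replace hab : a + b = d := Finset.HasAntidiagonal.mem_antidiagonal.1 hab
    simp [hF a (by omega)]

lemma natDegree_le_rowDeg {w : ℕ} (r : Fin w → Polynomial ℝ) (col : Fin w) :
    (r col).natDegree ≤ rowDeg r :=
  Finset.le_sup (f := fun i => (r i).natDegree) (Finset.mem_univ col)

/-- Predictable degree property: if the leading rows are independent and every entry of `F R`
has degree less than `L`, then so has every `F j` shifted by the degree of row `j`. -/
lemma coeff_eq_zero_of_vecMul_degree_lt {q w : ℕ} {R : Matrix (Fin q) (Fin w) (Polynomial ℝ)}
    (hR : LinearIndependent ℝ (leadingRowCoeffMat R).row) {L : ℕ} {F : Fin q → Polynomial ℝ}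
    (hF : ∀ col, (Matrix.vecMul F R col).degree < (L : WithBot ℕ)) (j : Fin q) (i : ℕ)
    (hi : L ≤ i + rowDeg (R j)) : (F j).coeff i = 0 := by
  have descend : ∀ k, (∀ j i, L + k ≤ i + rowDeg (R j) → (F j).coeff i = 0) →
      ∀ j i, L ≤ i + rowDeg (R j) → (F j).coeff i = 0 := by
    intro k
    induction k with
    | zero => exact fun h => h
    | succ k ih =>
      refine fun h => ih fun j i hji => ?_
      rcases hji.lt_or_eq with hlt | heq
      · exact h j i (by omega)
      have hzero := Fintype.linearIndependent_iff.1 hR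
        (fun j => if rowDeg (R j) ≤ L + k then (F j).coeff (L + k - rowDeg (R j)) else 0) (by
          ext col
          have hc : (Matrix.vecMul F R col).coeff (L + k) = 0 :=
            coeff_eq_zero_of_degree_lt ((hF col).trans_le (by exact_mod_cast Nat.le_add_right L k))
          rw [Matrix.vecMul, dotProduct, finsetSum_coeff] at hc
          rw [Finset.sum_apply, Pi.zero_apply]
          refine Eq.trans ?_ hc
          refine Finset.sum_congr rfl fun j _ => ?_
          rw [coeff_mul_of_top_le (natDegree_le_rowDeg (R j) col)
            fun i hi => h j i (by omega)]
          rfl) j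
      simp only [heq, Nat.le_add_left, if_true, Nat.add_sub_cancel] at hzero
      exact hzero
  refine descend (Finset.univ.sup fun j => (F j).natDegree + rowDeg (R j) + 1) ?_ j i hi
  intro j i hji
  have := Finset.le_sup (f := fun j => (F j).natDegree + rowDeg (R j) + 1) (Finset.mem_univ j)
  exact coeff_eq_zero_of_natDegree_lt (by omega)

theorem corollary2 {q w : ℕ} (R : Matrix (Fin q) (Fin w) (Polynomial ℝ))
    (hrowreduced : (leadingRowCoeffMat R).rank = q)
    (L : ℕ) (hL : ∀ j : Fin q, rowDeg (R j) ≤ L)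
    (S : Submodule ℝ (Fin w → Polynomial ℝ))
    (hS : (S : Set (Fin w → Polynomial ℝ))
        = {nn | (∀ col : Fin w, (nn col).degree < (L : WithBot ℕ)) ∧
            ∃ F : Fin q → Polynomial ℝ, nn = Matrix.vecMul F R}) :
    Module.finrank ℝ S = q * L - ∑ j : Fin q, rowDeg (R j) ∧
    LinearIndependent ℝ
      (fun idx : Σ j : Fin q, Fin (L - rowDeg (R j)) =>
        (fun col : Fin w => (X : Polynomial ℝ) ^ (idx.2 : ℕ) * R idx.1 col)) ∧
    Submodule.span ℝ (Set.range
      (fun idx : Σ j : Fin q, Fin (L - rowDeg (R j)) =>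
        (fun col : Fin w => (X : Polynomial ℝ) ^ (idx.2 : ℕ) * R idx.1 col))) = S := by
  have hR : LinearIndependent ℝ (leadingRowCoeffMat R).row :=
    linearIndependent_iff_card_eq_finrank_span.2 (by
      rw [Fintype.card_fin, Set.finrank, ← Matrix.rank_eq_finrank_span_row, hrowreduced])
  set b := fun idx : Σ j : Fin q, Fin (L - rowDeg (R j)) =>
    (fun col : Fin w => (X : Polynomial ℝ) ^ (idx.2 : ℕ) * R idx.1 col) with hb
  have hind : LinearIndependent ℝ b := by
    rw [Fintype.linearIndependent_iff]
    rintro g hg ⟨j, i⟩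
    have hcoeff := coeff_eq_zero_of_vecMul_degree_lt hR (L := 0)
      (F := fun j => ∑ i : Fin (L - rowDeg (R j)), C (g ⟨j, i⟩) * X ^ (i : ℕ)) (by
        intro col
        have hcol := congrFun hg col
        rw [Fintype.sum_sigma, Finset.sum_apply] at hcol
        have hvec : Matrix.vecMul
            (fun j => ∑ i : Fin (L - rowDeg (R j)), C (g ⟨j, i⟩) * X ^ (i : ℕ)) R col = 0 := by
          rw [Matrix.vecMul, dotProduct, ← Pi.zero_apply (M := fun _ => Polynomial ℝ) col, ← hcol]
          refine Finset.sum_congr rfl fun j _ => ?_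
          simp [hb, Finset.sum_mul, smul_eq_C_mul, mul_assoc]
        rw [hvec, degree_zero]
        exact WithBot.bot_lt_coe 0) j i (Nat.zero_le _)
    simpa [finsetSum_coeff, coeff_C_mul, coeff_X_pow, Fin.val_inj] using hcoeff
  have hmem : ∀ nn, nn ∈ S ↔ (∀ col : Fin w, (nn col).degree < (L : WithBot ℕ)) ∧
      ∃ F : Fin q → Polynomial ℝ, nn = Matrix.vecMul F R := fun nn => Set.ext_iff.1 hS nn
  have hspan : Submodule.span ℝ (Set.range b) = S := by
    refine le_antisymm (Submodule.span_le.2 ?_) fun nn hnn => ?_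
    · rintro _ ⟨⟨j, i⟩, rfl⟩
      refine (hmem _).2 ⟨fun col => ?_, Pi.single j (X ^ (i : ℕ)), ?_⟩
      · refine degree_le_natDegree.trans_lt ?_
        have hdeg : (X ^ (i : ℕ) * R j col).natDegree ≤ i + rowDeg (R j) :=
          natDegree_mul_le_of_le (natDegree_X_pow_le _) (natDegree_le_rowDeg (R j) col)
        have hi := i.isLt
        exact_mod_cast (by omega : (X ^ (i : ℕ) * R j col).natDegree < L)
      · rw [Matrix.single_vecMul]
        rfl
    · obtain ⟨hdeg, F, rfl⟩ := (hmem nn).1 hnn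
      have hF := coeff_eq_zero_of_vecMul_degree_lt hR hdeg
      have hsum : Matrix.vecMul F R = ∑ j, ∑ i : Fin (L - rowDeg (R j)),
          (F j).coeff i • b ⟨j, i⟩ := by
        ext1 col
        rw [Matrix.vecMul, dotProduct, Finset.sum_apply]
        refine Finset.sum_congr rfl fun j _ => ?_
        have hFj : F j = ∑ i : Fin (L - rowDeg (R j)), C ((F j).coeff i) * X ^ (i : ℕ) := by
          ext n
          rw [Fin.sum_univ_eq_sum_range fun i => C ((F j).coeff i) * X ^ i]
          simp only [finsetSum_coeff, coeff_C_mul, coeff_X_pow, mul_ite, mul_one, mul_zero,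
            Finset.sum_ite_eq, Finset.mem_range]
          split_ifs with hn
          · rfl
          · exact hF j n (by omega)
        conv_lhs => rw [hFj]
        simp [hb, Finset.sum_mul, smul_eq_C_mul, mul_assoc]
      rw [hsum]
      exact Submodule.sum_mem _ fun j _ => Submodule.sum_mem _ fun i _ =>
        Submodule.smul_mem _ _ (Submodule.subset_span ⟨⟨j, i⟩, rfl⟩)
  refine ⟨?_, hind, hspan⟩
  rw [← hspan, finrank_span_eq_card hind, Fintype.card_sigma]
  simp only [Fintype.card_fin]
  rw [Finset.sum_tsub_distrib _ fun j _ => hL j]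
  simp
end

section
/- Divisibility step in the proof of Theorem 1 (closure of the row module of a minimal kernel under division by scalar polynomials): let R ∈ M_{q×w}(ℂ[X]) be a polynomial matrix such that the evaluated matrix R(λ) ∈ M_{q×w}(ℂ) has rank q for every λ ∈ ℂ. If f ∈ ℂ[X] is a nonzero polynomial and r ∈ (ℂ[X])^{1×w}, F ∈ (ℂ[X])^{1×q} satisfy f·r = F·R, then f divides every entry of F; consequently there exists F' ∈ (ℂ[X])^{1×q} with r = F'·R, i.e. r lies in the ℂ[X]-row module of R. -/
/-!
Statement 11: divisibility step in the proof of Theorem 1. If `R(λ)` has full row rank `q`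
for every `λ ∈ ℂ` and `f·r = F·R` with `f ≠ 0`, then `f` divides every entry of `F`, and
hence `r` lies in the ℂ[X]-row module of `R`.
-/

open Polynomial

theorem Matrix.vecMul_injective_of_rank_eq_card {m n K : Type*} [Fintype m] [Fintype n] [Field K]
    (A : Matrix m n K) (hA : A.rank = Fintype.card m) : Function.Injective A.vecMul := by
  rw [Matrix.vecMul_injective_iff, linearIndependent_iff_card_eq_finrank_span, ← hA,
    Matrix.rank_eq_finrank_span_row]
  rfl

theorem Polynomial.dvd_of_irreducible_of_isRoot {K : Type*} [Field K] {p g : K[X]} {a : K}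
    (hp : Irreducible p) (hpa : p.IsRoot a) (hg : g.IsRoot a) : p ∣ g :=
  ((irreducible_X_sub_C a).dvd_symm hp (dvd_iff_isRoot.mpr hpa)).trans (dvd_iff_isRoot.mpr hg)

/-- Over an algebraically closed field, if a polynomial matrix has full row rank at every point,
then any scalar polynomial dividing a combination of its rows divides the coefficients. -/
theorem Polynomial.dvd_of_smul_eq_vecMul {m n K : Type*} [Fintype m] [Fintype n] [Field K]
    [IsAlgClosed K] (R : Matrix m n K[X])
    (hR : ∀ a : K, (R.map (eval a)).rank = Fintype.card m) {f : K[X]} (hf : f ≠ 0)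
    (r : n → K[X]) (F : m → K[X]) (h : f • r = Matrix.vecMul F R) (j : m) : f ∣ F j := by
  induction f using WfDvdMonoid.induction_on_irreducible generalizing F j with
  | zero => exact absurd rfl hf
  | unit u hu => exact hu.dvd
  | mul g p hg hp ih =>
    obtain ⟨a, ha⟩ := IsAlgClosed.exists_root p (degree_pos_of_irreducible hp).ne'
    have hF : (fun i => (F i).eval a) = 0 := by
      apply Matrix.vecMul_injective_of_rank_eq_card _ (hR a)
      funext k
      have hk := RingHom.map_vecMul (evalRingHom a) R F k
      rw [← h] at hk
      have hpa : p.eval a = 0 := ha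
      simpa [hpa, Function.comp_def] using hk.symm
    have hpF : ∀ i, p ∣ F i := fun i => dvd_of_irreducible_of_isRoot hp ha (congrFun hF i)
    choose G hG using hpF
    have hFG : F = p • G := by ext1 i; exact hG i
    rw [hG j]
    refine mul_dvd_mul_left p (ih hg G ?_ j)
    rw [hFG, Matrix.smul_vecMul, mul_smul] at h
    exact smul_right_injective _ hp.ne_zero h

theorem divisibility_step {q w : ℕ} (R : Matrix (Fin q) (Fin w) (Polynomial ℂ))
    (hR : ∀ lam : ℂ, (R.map (fun pol => Polynomial.eval lam pol)).rank = q)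
    (f : Polynomial ℂ) (hf : f ≠ 0)
    (r : Fin w → Polynomial ℂ) (F : Fin q → Polynomial ℂ)
    (h : (fun col : Fin w => f * r col) = Matrix.vecMul F R) :
    (∀ j : Fin q, f ∣ F j) ∧ ∃ F' : Fin q → Polynomial ℂ, r = Matrix.vecMul F' R := by
  have hdvd : ∀ j, f ∣ F j :=
    Polynomial.dvd_of_smul_eq_vecMul R (by simpa using hR) hf r F h
  choose G hG using hdvd
  refine ⟨fun j => ⟨G j, hG j⟩, G, smul_right_injective _ hf ?_⟩
  change f • r = f • Matrix.vecMul G R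
  rw [← Matrix.smul_vecMul, ← show F = f • G from funext hG]
  exact h
end

section
/- Embedding of an affine LPV-IO representation into an implicit LTI form (Section 5): let a_{i,j} ∈ ℝ^{ny×ny} for i = 1,…,na and j = 0,…,np, and b_{i,j} ∈ ℝ^{ny×nu} for i = 1,…,nb and j = 0,…,np, and define the affine coefficient functions a_i(p) = a_{i,0} + Σ_{j=1}^{np} p_j·a_{i,j} and b_i(p) = b_{i,0} + Σ_{j=1}^{np} p_j·b_{i,j} for p ∈ ℝ^{np}. For signals u : ℤ → ℝ^{nu}, y : ℤ → ℝ^{ny}, p : ℤ → ℝ^{np}, define the extended signals 𝗎(k) = (u(k); p(k) ⊗ u(k)) ∈ ℝ^{(1+np)·nu} and 𝗒(k) = (y(k); p(k) ⊗ y(k)) ∈ ℝ^{(1+np)·ny}, and the real matrices E = [I_{ny} 0] ∈ ℝ^{ny×(1+np)ny}, A_i = [a_{i,0} a_{i,1} ⋯ a_{i,np}], B_i = [b_{i,0} b_{i,1} ⋯ b_{i,np}]. Then for every k ∈ ℤ, the parameter-varying difference equation y(k) + Σ_{i=1}^{na} a_i(p(k−i))·y(k−i) = Σ_{i=1}^{nb}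 b_i(p(k−i))·u(k−i) holds if and only if the linear relation E·𝗒(k) + Σ_{i=1}^{na} A_i·𝗒(k−i) = Σ_{i=1}^{nb} B_i·𝗎(k−i) holds. -/
/-!
Statement 12: embedding of an affine LPV-IO representation into an implicit LTI form.
Coefficient families are indexed by `i : Fin na` (resp. `Fin nb`), representing the
paper's lags `i+1 = 1, …, na`, and by `j : Fin (np+1)`, representing `j = 0, …, np`.
-/

open Matrix

/-- The affine coefficient function `a_i(p) = a_{i,0} + ∑_{j=1}^{np} p_j · a_{i,j}`. -/
def affCoef {r c np : ℕ} (a : Fin (np + 1) → Matrix (Fin r) (Fin c) ℝ)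
    (pv : Fin np → ℝ) : Matrix (Fin r) (Fin c) ℝ :=
  a 0 + ∑ j : Fin np, pv j • a j.succ

/-- The extended signal `(v ; p ⊗ v)`: block `0` is `v` and block `j+1` is `p_j · v`. -/
def extSig {np d : ℕ} (pv : Fin np → ℝ) (v : Fin d → ℝ) : Fin (np + 1) × Fin d → ℝ :=
  fun jc => (Fin.cons 1 pv : Fin (np + 1) → ℝ) jc.1 * v jc.2

/-- Horizontal block concatenation `[a_0  a_1  ⋯  a_np]`. -/
def blockConcat {r c np : ℕ} (a : Fin (np + 1) → Matrix (Fin r) (Fin c) ℝ) :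
    Matrix (Fin r) (Fin (np + 1) × Fin c) ℝ :=
  fun i jc => a jc.1 i jc.2

/-- The matrix `E = [I 0]`. -/
def Emat (ny np : ℕ) : Matrix (Fin ny) (Fin (np + 1) × Fin ny) ℝ :=
  fun i jc => if jc.1 = 0 ∧ jc.2 = i then 1 else 0

/-- The block row `[a_0 ⋯ a_np]` applied to the extended signal is the affine coefficient
applied to the original signal. -/
theorem blockConcat_mulVec_extSig {r c np : ℕ}
    (a : Fin (np + 1) → Matrix (Fin r) (Fin c) ℝ) (pv : Fin np → ℝ) (v : Fin c → ℝ) :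
    (blockConcat a).mulVec (extSig pv v) = (affCoef a pv).mulVec v := by
  have hsum : (affCoef a pv).mulVec v
      = (a 0).mulVec v + ∑ j : Fin np, pv j • (a j.succ).mulVec v := by
    simp only [affCoef, Matrix.add_mulVec, Matrix.sum_mulVec, Matrix.smul_mulVec]
  rw [hsum]
  ext i
  simp [Matrix.mulVec, dotProduct, blockConcat, extSig, Fintype.sum_prod_type,
    Fin.sum_univ_succ, Finset.mul_sum, mul_left_comm]

/-- The matrix `E = [I 0]` recovers the original signal from the extended one. -/
theorem Emat_mulVec_extSig {ny np : ℕ} (pv : Fin np → ℝ) (v : Fin ny → ℝ) :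
    (Emat ny np).mulVec (extSig pv v) = v := by
  ext i
  simp [Matrix.mulVec, dotProduct, Emat, extSig, Fintype.sum_prod_type, Fin.sum_univ_succ]

/-- **Embedding of an affine LPV-IO representation into an implicit LTI form.**
For every `k ∈ ℤ`, the parameter-varying difference equation
`y(k) + ∑ᵢ aᵢ(p(k−i)) y(k−i) = ∑ᵢ bᵢ(p(k−i)) u(k−i)` holds iff the linear relation
`E 𝗒(k) + ∑ᵢ Aᵢ 𝗒(k−i) = ∑ᵢ Bᵢ 𝗎(k−i)` holds, where `𝗎(k) = (u(k); p(k) ⊗ u(k))`,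
`𝗒(k) = (y(k); p(k) ⊗ y(k))`, `Aᵢ = [a_{i,0} ⋯ a_{i,np}]` and `Bᵢ = [b_{i,0} ⋯ b_{i,np}]`. -/
theorem lpv_io_embedding {ny nu np na nb : ℕ}
    (a : Fin na → Fin (np + 1) → Matrix (Fin ny) (Fin ny) ℝ)
    (b : Fin nb → Fin (np + 1) → Matrix (Fin ny) (Fin nu) ℝ)
    (u : ℤ → Fin nu → ℝ) (y : ℤ → Fin ny → ℝ) (p : ℤ → Fin np → ℝ) (k : ℤ) :
    (y k + ∑ i : Fin na,
        (affCoef (a i) (p (k - ((i : ℕ) + 1)))).mulVec (y (k - ((i : ℕ) + 1)))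
      = ∑ i : Fin nb,
          (affCoef (b i) (p (k - ((i : ℕ) + 1)))).mulVec (u (k - ((i : ℕ) + 1))))
    ↔
    ((Emat ny np).mulVec (extSig (p k) (y k))
        + ∑ i : Fin na,
            (blockConcat (a i)).mulVec (extSig (p (k - ((i : ℕ) + 1))) (y (k - ((i : ℕ) + 1))))
      = ∑ i : Fin nb,
          (blockConcat (b i)).mulVec (extSig (p (k - ((i : ℕ) + 1))) (u (k - ((i : ℕ) + 1))))) := by
  simp only [blockConcat_mulVec_extSig, Emat_mulVec_extSig]
end

section
/- Reduction of affine parameter-varying annihilation conditions to constant-coefficient conditions on the extended Hankel matrix (Section 5 link): let r_{i,j} ∈ ℝ^{1×nw} for i = 0,…,L−1 and j = 0,…,np, and define the affine row-coefficient functions r_i(p) = r_{i,0} + Σ_{j=1}^{np} p_j·r_{i,j} for p ∈ ℝ^{np}. Let w : {1,…,T} → ℝ^{nw} and p : {1,…,T} → ℝ^{np}, and define the extended signal w_ext(k) = (w(k); p(k) ⊗ w(k)) ∈ ℝ^{(1+np)·nw}. Then for every column index c with 1 ≤ c ≤ T − L + 1, Σ_{i=0}^{L−1} r_i(p(c+i))·w(c+i)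 = r̃ · [H_L(w_ext)]_{:,c}, where r̃ = [r_{0,0} r_{0,1} ⋯ r_{0,np} r_{1,0} ⋯ r_{L−1,np}] ∈ ℝ^{1×L(1+np)nw} is the constant row vector obtained by concatenating all coefficient blocks; consequently, the parameter-varying row (r_0(p(c)), …, r_{L−1}(p(c+L−1))) annihilates every column of the Hankel matrix H_L(w) if and only if the constant row vector r̃ lies in the left kernel of the extended Hankel matrix H_L(w_ext). -/
/-!
Statement 13: reduction of affine parameter-varying annihilation conditions to
constant-coefficient conditions on the extended Hankel matrix. 0-based time indexing:
times k = 0, …, T−1 correspond to the paper's 1, …, T, and columns c = 0, …, T−L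
correspond to the paper's 1, …, T−L+1. Row coefficients are indexed by `i : Fin L`
(the lag) and `j : Fin (np+1)` (the affine term, `j = 0` being the constant part).
-/

open Matrix

/-- The affine row-coefficient function `r_i(p) = r_{i,0} + ∑_{j=1}^{np} p_j · r_{i,j}`. -/
def affRow {nw np : ℕ} (r : Fin (np + 1) → Fin nw → ℝ) (pv : Fin np → ℝ) : Fin nw → ℝ :=
  r 0 + ∑ j : Fin np, pv j • r j.succ

/-- Hankel matrix of depth `L` of a signal `v` on `{0, …, T−1}`: block `(i, c)` is
`v (c + i)`. -/
def hankel {ι : Type*} (T L : ℕ) (v : ℕ → ι → ℝ) :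
    Matrix (Fin L × ι) (Fin (T - L + 1)) ℝ :=
  fun ic c => v ((c : ℕ) + (ic.1 : ℕ)) ic.2

/-- An affine row applied to `v` is the stacked coefficient row applied to `(v ; p ⊗ v)`. -/
theorem affRow_dotProduct {nw np : ℕ} (r : Fin (np + 1) → Fin nw → ℝ) (pv : Fin np → ℝ)
    (v : Fin nw → ℝ) :
    affRow r pv ⬝ᵥ v = (fun jc : Fin (np + 1) × Fin nw => r jc.1 jc.2) ⬝ᵥ extSig pv v := by
  rw [affRow, add_dotProduct, sum_dotProduct]
  simp only [dotProduct, extSig, Fintype.sum_prod_type, Fin.sum_univ_succ, Fin.cons_zero,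
    Fin.cons_succ, one_mul, Pi.smul_apply, smul_eq_mul]
  congr! 3
  ring

/-- **Reduction of affine PV annihilation to constant-coefficient annihilation.**
For each column `c`, `∑ᵢ rᵢ(p(c+i)) · w(c+i) = r̃ · [H_L(w_ext)]_{:,c}` where
`w_ext(k) = (w(k); p(k) ⊗ w(k))` and `r̃` stacks all coefficient blocks `r_{i,j}`;
consequently, the parameter-varying row annihilates every column of `H_L(w)` iff the
constant row vector `r̃` lies in the left kernel of the extended Hankel matrix. -/
theorem affine_annihilator_reduction {nw np : ℕ} (T L : ℕ) (hLT : L ≤ T)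
    (r : Fin L → Fin (np + 1) → Fin nw → ℝ)
    (w : ℕ → Fin nw → ℝ) (p : ℕ → Fin np → ℝ) :
    (∀ c : Fin (T - L + 1),
        ∑ i : Fin L, affRow (r i) (p ((c : ℕ) + (i : ℕ))) ⬝ᵥ w ((c : ℕ) + (i : ℕ))
          = Matrix.vecMul (fun idx : Fin L × (Fin (np + 1) × Fin nw) => r idx.1 idx.2.1 idx.2.2)
              (hankel T L (fun k => extSig (p k) (w k))) c) ∧
    ((∀ c : Fin (T - L + 1),
        ∑ i : Fin L, affRow (r i) (p ((c : ℕ) + (i : ℕ))) ⬝ᵥ w ((c : ℕ) + (i : ℕ)) = 0)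
      ↔ Matrix.vecMul (fun idx : Fin L × (Fin (np + 1) × Fin nw) => r idx.1 idx.2.1 idx.2.2)
          (hankel T L (fun k => extSig (p k) (w k))) = 0) := by
  have column_eq : ∀ c : Fin (T - L + 1),
      ∑ i : Fin L, affRow (r i) (p ((c : ℕ) + (i : ℕ))) ⬝ᵥ w ((c : ℕ) + (i : ℕ))
        = Matrix.vecMul (fun idx : Fin L × (Fin (np + 1) × Fin nw) => r idx.1 idx.2.1 idx.2.2)
            (hankel T L (fun k => extSig (p k) (w k))) c := by
    intro c
    simp only [affRow_dotProduct]
    simp only [vecMul, dotProduct, hankel, Fintype.sum_prod_type]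
  refine ⟨column_eq, ?_⟩
  simp only [column_eq, funext_iff, Pi.zero_apply]
end
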